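/- arXiv:2404.01381 — 2 statements merged into one kernel-verified Lean document; each statement's English description precedes it below -/
import Mathlib

section
/- Let Γ be a finite connected graph that is a tree (first Betti number zero), equipped with a 2-colouring r : V(Γ) → {1,2} such that every edge joins a vertex of colour 1 to a vertex of colour 2, and with an assignment to each vertex V of a set n_V ⊆ {1,2} such that the sets n_V form a partition of {1,2}. Assume: (i) every vertex V satisfies deg(V) + |n_V| ≥ 2; (ii) every vertex of colour 1 has degree at most 1; (iii) the element 2 lies in n_V for a vertex V of colour 2; (iv) Γ has at least one vertex of colour 1 and at least one vertex of colour 2. Then Γ consists of exactly two vertices, V₁ of colour 1 and V₂ of colour 2, joined by a single edge, with n_{V₁} = {1} and n_{V₂} = {2}. -/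
/-- A finite connected tree with a proper 2-colouring `r : V → {1,2}`,
marking sets `n_V ⊆ {1,2}` partitioning `{1,2}`, such that every vertex satisfies
`deg V + |n_V| ≥ 2`, every colour-1 vertex has degree ≤ 1, the vertex carrying the
marking `2` has colour 2, and both colours occur, must consist of exactly two
vertices `V₁` (colour 1) and `V₂` (colour 2) joined by a single edge, with
`n_{V₁} = {1}` and `n_{V₂} = {2}`. -/
theorem stmt_0 {V : Type*} [Fintype V] (G : SimpleGraph V) [DecidableRel G.Adj]
    (htree : G.IsTree)
    (r : V → ℕ) (hr : ∀ v, r v = 1 ∨ r v = 2)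
    (hbip : ∀ u v, G.Adj u v → (r u = 1 ∧ r v = 2) ∨ (r u = 2 ∧ r v = 1))
    (n : V → Finset ℕ) (hsub : ∀ v, n v ⊆ {1, 2})
    (hpart : ∀ i ∈ ({1, 2} : Finset ℕ), ∃! v : V, i ∈ n v)
    (hstab : ∀ v, 2 ≤ G.degree v + (n v).card)
    (hdeg1 : ∀ v, r v = 1 → G.degree v ≤ 1)
    (hmark2 : ∀ v, 2 ∈ n v → r v = 2)
    (hocc1 : ∃ v, r v = 1) (hocc2 : ∃ v, r v = 2) :
    ∃ v₁ v₂ : V, v₁ ≠ v₂ ∧ (∀ v, v = v₁ ∨ v = v₂) ∧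
      r v₁ = 1 ∧ r v₂ = 2 ∧ G.Adj v₁ v₂ ∧
      G.edgeSet = {s(v₁, v₂)} ∧ n v₁ = {1} ∧ n v₂ = {2} := by
  have key : ∀ v, r v = 1 → n v = {1} ∧ G.degree v = 1 := by
    intro v hv
    have h2 : 2 ∉ n v := fun h => by
      have := hmark2 v h
      omega
    have hs : n v ⊆ {1} := by
      intro x hx
      have := hsub v hx
      simp only [Finset.mem_insert, Finset.mem_singleton] at this ⊢
      rcases this with h | h
      · exact h
      · subst h
        exact absurd hx h2
    have hc := Finset.card_le_card hs
    have hd := hdeg1 v hv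
    have hst := hstab v
    rw [Finset.card_singleton] at hc
    refine ⟨Finset.eq_of_subset_of_card_le hs ?_, by omega⟩
    rw [Finset.card_singleton]
    omega
  obtain ⟨a, ha⟩ := hocc1
  obtain ⟨hna, hda⟩ := key a ha
  have h1a : 1 ∈ n a := by simp [hna]
  have uniq1 : ∀ v, 1 ∈ n v → v = a := fun v hv =>
    (hpart 1 (by simp)).unique hv h1a
  have col1 : ∀ v, r v = 1 → v = a := fun v hv => uniq1 v (by simp [(key v hv).1])
  obtain ⟨b, hab, hb⟩ := SimpleGraph.degree_eq_one_iff_existsUnique_adj.1 hda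
  have hrb : r b = 2 := by
    rcases hbip a b hab with h | h <;> omega
  have all : ∀ v, v = a ∨ v = b := by
    intro v
    rcases hr v with h | h
    · exact Or.inl (col1 v h)
    · right
      have h1 : 1 ∉ n v := fun h' => by
        have := uniq1 v h'
        subst this
        omega
      have hs : n v ⊆ {2} := by
        intro x hx
        have := hsub v hx
        simp only [Finset.mem_insert, Finset.mem_singleton] at this ⊢
        rcases this with h | h
        · subst h
          exact absurd hx h1
        · exact h
      have hc := Finset.card_le_card hs
      rw [Finset.card_singleton] at hc
      have hst := hstab v
      have hpos : 0 < G.degree v := by omega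
      obtain ⟨w, hw⟩ := (G.degree_pos_iff_exists_adj v).1 hpos
      have hrw : r w = 1 := by
        rcases hbip v w hw with h | h <;> omega
      have := col1 w hrw
      subst this
      exact hb v hw.symm
  refine ⟨a, b, hab.ne, all, ha, hrb, hab, ?_, hna, ?_⟩
  · ext e
    induction e using Sym2.ind with
    | _ x y =>
      rw [SimpleGraph.mem_edgeSet, Set.mem_singleton_iff, Sym2.eq_iff]
      constructor
      · intro h
        have hne := h.ne
        rcases all x with hx | hx <;> rcases all y with hy | hy <;> subst hx <;>
          first
          | (subst hy; first | exact absurd rfl hne | simp)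
          | simp_all
      · rintro (⟨rfl, rfl⟩ | ⟨rfl, rfl⟩)
        · exact hab
        · exact hab.symm
  · obtain ⟨w, hw, -⟩ := hpart 2 (by simp)
    have hwb : w = b := by
      rcases all w with h | h
      · have := hmark2 w hw
        subst h
        omega
      · exact h
    subst hwb
    have h1 : 1 ∉ n w := fun h' => hab.ne (uniq1 w h').symm
    ext x
    rw [Finset.mem_singleton]
    constructor
    · intro hx
      have := hsub w hx
      simp only [Finset.mem_insert, Finset.mem_singleton] at this
      rcases this with h | h
      · subst h
        exact absurd hx h1
      · exact h
    · rintro rfl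
      exact hw
end

section
/- Let R be a commutative ring, let L₁ and L₂ be R-modules equipped with an R-module isomorphism ψ : L₁ ⊗_R L₂ ≅ R, and let u ∈ R be a unit. If s₁, s₁′ ∈ L₁ and s₂, s₂′ ∈ L₂ satisfy ψ(s₁ ⊗ s₂) = u = ψ(s₁′ ⊗ s₂′), then there exists a unit r ∈ R such that s₁′ = r·s₁ and s₂′ = r⁻¹·s₂. -/
open scoped TensorProduct

/-- if `ψ : L₁ ⊗[R] L₂ ≅ R` is an isomorphism of `R`-modules, `u ∈ Rˣ`,
and `s₁, s₁′ ∈ L₁`, `s₂, s₂′ ∈ L₂` satisfy `ψ(s₁ ⊗ s₂) = u = ψ(s₁′ ⊗ s₂′)`, then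
there is a unit `r ∈ Rˣ` with `s₁′ = r • s₁` and `s₂′ = r⁻¹ • s₂`. -/
theorem stmt_6 {R : Type*} [CommRing R]
    {L₁ L₂ : Type*} [AddCommGroup L₁] [Module R L₁] [AddCommGroup L₂] [Module R L₂]
    (ψ : (L₁ ⊗[R] L₂) ≃ₗ[R] R) (u : Rˣ)
    (s₁ s₁' : L₁) (s₂ s₂' : L₂)
    (h : ψ (s₁ ⊗ₜ[R] s₂) = (u : R)) (h' : ψ (s₁' ⊗ₜ[R] s₂') = (u : R)) :
    ∃ r : Rˣ, s₁' = (r : R) • s₁ ∧ s₂' = ((r⁻¹ : Rˣ) : R) • s₂ := by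
  have : Module.Invertible R L₁ := Module.Invertible.left ψ
  have : Module.Invertible R L₂ := Module.Invertible.right ψ
  let f : L₁ →ₗ[R] R := ψ.toLinearMap ∘ₗ (TensorProduct.mk R L₁ L₂).flip s₂
  let g : L₂ →ₗ[R] R := ψ.toLinearMap ∘ₗ TensorProduct.mk R L₁ L₂ s₁
  have hf1 : f s₁ = u := h
  have hg1 : g s₂ = u := h
  have hf : Function.Bijective f := Module.Invertible.bijective_of_surjective fun x =>
    ⟨(x * ((u⁻¹ : Rˣ) : R)) • s₁, by rw [map_smul, hf1]; simp⟩
  have hg : Function.Bijective g := Module.Invertible.bijective_of_surjective fun x =>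
    ⟨(x * ((u⁻¹ : Rˣ) : R)) • s₂, by rw [map_smul, hg1]; simp⟩
  obtain ⟨a, ha⟩ : ∃ a : R, s₁' = a • s₁ :=
    ⟨f s₁' * ((u⁻¹ : Rˣ) : R), hf.1 (by rw [map_smul, hf1]; simp)⟩
  obtain ⟨c, hc⟩ : ∃ c : R, s₂' = c • s₂ :=
    ⟨g s₂' * ((u⁻¹ : Rˣ) : R), hg.1 (by rw [map_smul, hg1]; simp)⟩
  have hac : a * c = 1 := by
    rw [ha, hc, TensorProduct.smul_tmul_smul, map_smul, h, smul_eq_mul] at h'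
    exact u.isUnit.mul_right_cancel (by rw [h', one_mul])
  exact ⟨⟨a, c, hac, by rw [mul_comm, hac]⟩, ha, hc⟩
end
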